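/- Let Σ be a real n×n symmetric positive definite matrix, Σ̇ a real n×n symmetric matrix, μ, m ∈ ℝⁿ, and let S be a real n×n symmetric matrix with SΣ + ΣS = Σ̇. For a vector ν ∈ ℝⁿ and a symmetric positive definite matrix A, write ρ(x; ν, A) := det(2πA)^{−1/2} exp(−(1/2)(x−ν)ᵀA⁻¹(x−ν)). Then for every x ∈ ℝⁿ, the map t ↦ ρ(x; μ+tm, Σ+tΣ̇) (defined for t near 0, where Σ+tΣ̇ remains positive definite) is differentiable at t = 0 and d/dt|_{t=0} ρ(x; μ+tm, Σ+tΣ̇) = −div_x [ ρ(x; μ, Σ) (S(x−μ)+m) ], where div_x V denotes the divergence of the vector field V, i.e. the sum of the partial derivatives ∂V_i/∂x_i. -/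

import Mathlib

open MeasureTheory Matrix

/-- The divergence of a vector field on `ℝⁿ`: the sum of the partial derivatives
`∂V_i/∂x_i`. -/
noncomputable def divergence {n : ℕ} (V : (Fin n → ℝ) → (Fin n → ℝ))
    (x : Fin n → ℝ) : ℝ :=
  ∑ i, fderiv ℝ V x (Pi.single i 1) i

/-- The Gaussian density `ρ(x; ν, A) = det(2πA)^{−1/2} exp(−½(x−ν)ᵀA⁻¹(x−ν))`. -/
noncomputable def gauss {n : ℕ} (ν : Fin n → ℝ) (A : Matrix (Fin n) (Fin n) ℝ)
    (x : Fin n → ℝ) : ℝ :=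
  (Real.sqrt (((2 * Real.pi) • A).det))⁻¹ *
    Real.exp (-(1/2) * ((x - ν) ⬝ᵥ (A⁻¹ *ᵥ (x - ν))))

open scoped Matrix.Norms.Operator in
/-- The derivative at `0` of the entries of `(A + t B)⁻¹`. -/
theorem hasDerivAt_inv_add_smul_apply {n : ℕ} {A : Matrix (Fin n) (Fin n) ℝ}
    (hA : IsUnit A) (B : Matrix (Fin n) (Fin n) ℝ) (i j : Fin n) :
    HasDerivAt (fun t : ℝ => (A + t • B)⁻¹ i j) (-(A⁻¹ * B * A⁻¹) i j) 0 := by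
  obtain ⟨u, rfl⟩ := hA
  have hline : HasDerivAt (fun t : ℝ => (u : Matrix (Fin n) (Fin n) ℝ) + t • B) B 0 :=
    (((hasDerivAt_id (0 : ℝ)).smul_const B).const_add _).congr_deriv (one_smul ℝ B)
  have hinv := hasFDerivAt_ringInverse (𝕜 := ℝ) u
  have hcomp : HasDerivAt
      (fun t : ℝ => Ring.inverse ((u : Matrix (Fin n) (Fin n) ℝ) + t • B))
      (-(((u⁻¹ : (Matrix (Fin n) (Fin n) ℝ)ˣ) : Matrix (Fin n) (Fin n) ℝ) * B *
        ((u⁻¹ : (Matrix (Fin n) (Fin n) ℝ)ˣ) : Matrix (Fin n) (Fin n) ℝ))) 0 :=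
    HasFDerivAt.comp_hasDerivAt_of_eq (0 : ℝ) hinv hline (by simp)
  have hentry := ((Matrix.entryLinearMap ℝ ℝ i j).toContinuousLinearMap.hasFDerivAt).comp_hasDerivAt
    (0 : ℝ) hcomp
  simp only [Matrix.nonsing_inv_eq_ringInverse, Ring.inverse_unit]
  exact hentry

/-- Jacobi's formula at `0` for the determinant of `A + t B`. -/
theorem hasDerivAt_det_add_smul {n : ℕ} {A : Matrix (Fin n) (Fin n) ℝ}
    (hA : IsUnit A.det) (B : Matrix (Fin n) (Fin n) ℝ) :
    HasDerivAt (fun t : ℝ => (A + t • B).det) (A.det * (A⁻¹ * B).trace) 0 := by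
  have hfactor (t : ℝ) : (A + t • B).det = A.det * (1 + t • (A⁻¹ * B)).det := by
    rw [← det_mul, mul_add, mul_one, mul_smul_comm, Matrix.mul_nonsing_inv_cancel_left _ _ hA]
  rw [funext fun t => (hfactor t).trans (congrArg _ (det_one_add_smul t (A⁻¹ * B)))]
  have hpoly := (det (1 + (Polynomial.X : Polynomial ℝ) • (A⁻¹ * B).map Polynomial.C)).divX.divX
    |>.hasDerivAt (0 : ℝ)
  have h := ((((hasDerivAt_id (0 : ℝ)).const_mul (A⁻¹ * B).trace).const_add 1).add
    (hpoly.mul ((hasDerivAt_id (0 : ℝ)).pow 2))).const_mul A.det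
  simpa using h

/-- The derivative of the Gaussian density along a line in the parameter space. -/
theorem hasDerivAt_gauss {n : ℕ} {A : Matrix (Fin n) (Fin n) ℝ} (hA : A.PosDef)
    (B : Matrix (Fin n) (Fin n) ℝ) (μ m x : Fin n → ℝ) :
    HasDerivAt (fun t : ℝ => gauss (μ + t • m) (A + t • B) x)
      (gauss μ A x * (-(1 / 2) * (A⁻¹ * B).trace + m ⬝ᵥ (A⁻¹ *ᵥ (x - μ)) +
        1 / 2 * ((x - μ) ⬝ᵥ ((A⁻¹ * B * A⁻¹) *ᵥ (x - μ))))) 0 := by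
  have hdet := hA.det_pos
  have hd0 : 0 < (2 * Real.pi) ^ n * A.det := by positivity
  have hsqrt : HasDerivAt (fun t : ℝ => (Real.sqrt (((2 * Real.pi) • (A + t • B)).det))⁻¹)
      ((Real.sqrt (((2 * Real.pi) • A).det))⁻¹ * (-(1 / 2) * (A⁻¹ * B).trace)) 0 := by
    simp only [det_smul, Fintype.card_fin]
    have h := (((hasDerivAt_det_add_smul hdet.ne'.isUnit B).const_mul ((2 * Real.pi) ^ n)).sqrt
      (by simpa using hd0.ne')).inv (by simpa using (Real.sqrt_pos.2 hd0).ne')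
    refine h.congr_deriv ?_
    simp only [zero_smul, add_zero]
    have hs := Real.sq_sqrt hd0.le
    have hspos := Real.sqrt_pos.2 hd0
    set s := Real.sqrt ((2 * Real.pi) ^ n * A.det)
    rw [← mul_assoc, ← hs]
    field_simp
  have hv (i : Fin n) : HasDerivAt (fun t : ℝ => (x - (μ + t • m)) i) (-m i) 0 := by
    simpa using (((hasDerivAt_id (0 : ℝ)).mul_const (m i)).const_add (μ i)).const_sub (x i)
  have hquad : HasDerivAt
      (fun t : ℝ => (x - (μ + t • m)) ⬝ᵥ ((A + t • B)⁻¹ *ᵥ (x - (μ + t • m))))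
      (-2 * (m ⬝ᵥ (A⁻¹ *ᵥ (x - μ))) - (x - μ) ⬝ᵥ ((A⁻¹ * B * A⁻¹) *ᵥ (x - μ))) 0 := by
    have h := HasDerivAt.fun_sum (u := Finset.univ) fun i _ => (hv i).mul
      (HasDerivAt.fun_sum (u := Finset.univ) fun j _ =>
        (hasDerivAt_inv_add_smul_apply hA.isUnit B i j).mul (hv j))
    refine h.congr_deriv ?_
    have hsymm : (x - μ) ⬝ᵥ (A⁻¹ *ᵥ m) = m ⬝ᵥ (A⁻¹ *ᵥ (x - μ)) := by
      have hT : (A⁻¹)ᵀ = A⁻¹ := by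
        simpa [IsHermitian, conjTranspose_eq_transpose_of_trivial] using hA.inv.isHermitian.eq
      rw [dotProduct_mulVec, ← mulVec_transpose, hT, dotProduct_comm]
    have hsplit : -2 * (m ⬝ᵥ (A⁻¹ *ᵥ (x - μ))) = -(m ⬝ᵥ (A⁻¹ *ᵥ (x - μ))) -
        (x - μ) ⬝ᵥ (A⁻¹ *ᵥ m) := by rw [hsymm]; ring
    rw [hsplit]
    simp only [zero_smul, add_zero, dotProduct, mulVec, Pi.mul_apply, ← Finset.sum_neg_distrib,
      ← Finset.sum_sub_distrib]
    refine Finset.sum_congr rfl fun i _ => ?_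
    rw [Finset.sum_add_distrib]
    simp only [neg_mul, mul_neg, Finset.sum_neg_distrib]
    ring
  refine (hsqrt.mul (hquad.const_mul (-(1 / 2))).exp).congr_deriv ?_
  simp only [gauss, zero_smul, add_zero]
  ring

theorem differentiable_gauss {n : ℕ} (μ : Fin n → ℝ) (A : Matrix (Fin n) (Fin n) ℝ) :
    Differentiable ℝ (gauss μ A) := by
  unfold gauss
  simp only [dotProduct, mulVec, Pi.sub_apply]
  fun_prop

/-- The directional derivative of the Gaussian density in the space variable. -/
theorem hasLineDerivAt_gauss {n : ℕ} {A : Matrix (Fin n) (Fin n) ℝ} (hA : A.PosDef)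
    (μ x w : Fin n → ℝ) :
    HasLineDerivAt ℝ (gauss μ A) (-gauss μ A x * (w ⬝ᵥ (A⁻¹ *ᵥ (x - μ)))) x w := by
  have h := hasDerivAt_gauss hA 0 μ (-w) x
  have hshift (t : ℝ) : gauss (μ + t • -w) (A + t • 0) x = gauss μ A (x + t • w) := by
    have : x - (μ + t • -w) = x + t • w - μ := by module
    simp only [gauss, smul_zero, add_zero, this]
  simp_rw [hshift] at h
  refine HasDerivAt.congr_deriv h ?_
  simp

/-- The divergence of the Gaussian density times an affine vector field. -/
theorem divergence_gauss_smul_affine {n : ℕ} {A : Matrix (Fin n) (Fin n) ℝ} (hA : A.PosDef)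
    (S : Matrix (Fin n) (Fin n) ℝ) (μ m x : Fin n → ℝ) :
    divergence (fun y => gauss μ A y • (S *ᵥ (y - μ) + m)) x =
      gauss μ A x * (S.trace - (S *ᵥ (x - μ) + m) ⬝ᵥ (A⁻¹ *ᵥ (x - μ))) := by
  have hcoord (i : Fin n) :
      Differentiable ℝ (fun y : Fin n → ℝ => (S *ᵥ (y - μ) + m) i) := by
    simp only [mulVec, dotProduct, Pi.add_apply, Pi.sub_apply]
    fun_prop
  have hdiff : DifferentiableAt ℝ (fun y => gauss μ A y • (S *ᵥ (y - μ) + m)) x :=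
    (differentiable_gauss μ A x).smul (differentiableAt_pi.2 fun i => hcoord i x)
  have hpartial (i : Fin n) :
      fderiv ℝ (fun y => gauss μ A y • (S *ᵥ (y - μ) + m)) x (Pi.single i 1) i =
        gauss μ A x * (S i i - (S *ᵥ (x - μ) + m) i * (A⁻¹ *ᵥ (x - μ)) i) := by
    have hV := hasDerivAt_pi.1
      (hdiff.hasFDerivAt.hasLineDerivAt (Pi.single i 1)) i
    have hfield : HasDerivAt
        (fun t : ℝ => (S *ᵥ (x + t • Pi.single i 1 - μ) + m) i) (S i i) 0 := by
      have hline (t : ℝ) : (S *ᵥ (x + t • Pi.single i 1 - μ) + m) i =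
          (S *ᵥ (x - μ) + m) i + t * S i i := by
        rw [show x + t • Pi.single i 1 - μ = (x - μ) + t • Pi.single i 1 by module,
          mulVec_add, mulVec_smul]
        simp
        ring
      simp_rw [hline]
      simpa using ((hasDerivAt_id (0 : ℝ)).mul_const (S i i)).const_add ((S *ᵥ (x - μ) + m) i)
    have hg : HasDerivAt (fun t : ℝ => gauss μ A (x + t • Pi.single i 1)) _ 0 :=
      hasLineDerivAt_gauss hA μ x (Pi.single i 1)
    refine hV.unique ((hg.mul hfield).congr_deriv ?_)
    simp
    ring
  simp only [divergence, hpartial]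
  rw [← Finset.mul_sum, Finset.sum_sub_distrib]
  rfl

/-- In the multivariate Gaussian family, the elliptic equation defining the
Wasserstein metric tensor is solved by `∇Φ_ξ(x) = S(x−μ) + m` for a tangent
vector `ξ = (m, Σ̇)` with `S` symmetric solving the Lyapunov equation
`SΣ + ΣS = Σ̇`: the parameter derivative of the density equals
`−∇·(ρ(x; μ, Σ)(S(x−μ)+m))`. -/
theorem stmt18 {n : ℕ} (Sig Sigd S : Matrix (Fin n) (Fin n) ℝ)
    (hSig : Sig.PosDef) (hSigd : Sigd.IsSymm) (hS : S.IsSymm)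
    (hLyap : S * Sig + Sig * S = Sigd) (μ m : Fin n → ℝ) (x : Fin n → ℝ) :
    HasDerivAt (fun t : ℝ => gauss (μ + t • m) (Sig + t • Sigd) x)
      (-divergence (fun y => gauss μ Sig y • (S *ᵥ (y - μ) + m)) x) 0 := by
  have hunit : IsUnit Sig.det := hSig.det_pos.ne'.isUnit
  refine (hasDerivAt_gauss hSig Sigd μ m x).congr_deriv ?_
  rw [divergence_gauss_smul_affine hSig, ← hLyap]
  have htrace : (Sig⁻¹ * (S * Sig + Sig * S)).trace = 2 * S.trace := by
    rw [mul_add, trace_add, trace_mul_comm, Matrix.mul_assoc, mul_nonsing_inv _ hunit,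
      Matrix.nonsing_inv_mul_cancel_left _ _ hunit, Matrix.mul_one]
    ring
  have hquad : (x - μ) ⬝ᵥ ((Sig⁻¹ * (S * Sig + Sig * S) * Sig⁻¹) *ᵥ (x - μ)) =
      2 * ((S *ᵥ (x - μ)) ⬝ᵥ (Sig⁻¹ *ᵥ (x - μ))) := by
    have hT : (Sig⁻¹)ᵀ = Sig⁻¹ := by
      simpa [IsHermitian, conjTranspose_eq_transpose_of_trivial] using hSig.inv.isHermitian.eq
    have hprod : Sig⁻¹ * (S * Sig + Sig * S) * Sig⁻¹ = Sig⁻¹ * S + S * Sig⁻¹ := by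
      rw [mul_add, Matrix.nonsing_inv_mul_cancel_left _ _ hunit, add_mul, ← Matrix.mul_assoc,
        Matrix.mul_nonsing_inv_cancel_right _ _ hunit]
    have hleft (M N : Matrix (Fin n) (Fin n) ℝ) (hM : Mᵀ = M) (v : Fin n → ℝ) :
        v ⬝ᵥ ((M * N) *ᵥ v) = (M *ᵥ v) ⬝ᵥ (N *ᵥ v) := by
      rw [← mulVec_mulVec, dotProduct_mulVec, ← mulVec_transpose, hM]
    rw [hprod, add_mulVec, dotProduct_add, hleft _ _ hT, hleft _ _ hS.eq,
      dotProduct_comm (Sig⁻¹ *ᵥ (x - μ))]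
    ring
  rw [htrace, hquad, add_dotProduct]
  ring
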